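/- arXiv:2001.00490 — 2 statements merged into one kernel-verified Lean document; each statement's English description precedes it below -/
import Mathlib

section
/- Let α ∈ (0,1). For i = 0, 1 let G_i : ℝ² → ℝ have finite parabolic Hölder seminorm and be twice differentiable in x₁ away from {x₂ = 0} with |∂₁^k G_i(x)| ≤ C(G_i)·|x₂|^{(α−k)/2} (k = 1, 2), and assume additionally |∂₁^k(G_0 − G_1)(x)| ≤ C(G_0, G_1)·|x₂|^{(α−k)/2} for k = 1, 2 and all x with x₂ ≠ 0. Let F : ℝ² → ℝ be bounded with [F]_α < ∞. Then, with Comm_T^{G}(x) := G(x)·(F * ∂₁²ψ_T)(x) − ((F·G) * ∂₁²ψ_T)(x) + 2·((F·∂₁G) * ∂₁ψ_T)(x) − ((F·∂₁²G) * ψ_T)(x), there is a constant C(α) such that for all T ∈ (0,1] and x ∈ ℝ²: |Comm_T^{G_0}(x) − Comm_T^{G_1}(x)| ≤ C(α) · (C(G_0, G_1) + [G_0 − G_1]_α) · [F]_α · T^{(2α−2)/4}. -/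
open MeasureTheory

/-- The parabolic distance on `ℝ²`. -/
noncomputable def pdist (x y : ℝ × ℝ) : ℝ := |x.1 - y.1| + Real.sqrt |x.2 - y.2|

/-- Partial derivative in the first (space-like) variable. -/
noncomputable def pd1 (f : ℝ × ℝ → ℝ) : ℝ × ℝ → ℝ := fun x => deriv (fun s => f (s, x.2)) x.1

/-- Partial derivative in the second (time-like) variable. -/
noncomputable def pd2 (f : ℝ × ℝ → ℝ) : ℝ × ℝ → ℝ := fun x => deriv (fun s => f (x.1, s)) x.2

def IsPsiKernel (ψ : ℝ → ℝ × ℝ → ℝ) : Prop :=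
  (∀ T : ℝ, 0 < T → ∃ φ : SchwartzMap (ℝ × ℝ) ℝ, ψ T = ⇑φ) ∧
  (∃ C : ℝ, ∀ T : ℝ, 0 < T → ∀ k : ℝ × ℝ,
      (∫ x : ℝ × ℝ,
          Complex.exp (-(2 * Real.pi * (k.1 * x.1 + k.2 * x.2) : ℝ) * Complex.I) * (ψ T x : ℂ))
        = (C : ℂ) * Complex.exp ((-(T * (k.1 ^ 4 + k.2 ^ 2)) : ℝ) : ℂ)) ∧
  (∫ x : ℝ × ℝ, |ψ 1 x|) = 1

/-- The renormalized commutator `[G, (·)_T] ◊ ∂₁²F` associated with the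
generalized product `G ◊ ∂₁²F := ∂₁²(FG) - 2∂₁(F·∂₁G) + F·∂₁²G`. -/
noncomputable def commT (ψ : ℝ → ℝ × ℝ → ℝ) (T : ℝ) (F G : ℝ × ℝ → ℝ) (x : ℝ × ℝ) : ℝ :=
  G x * (∫ y : ℝ × ℝ, F y * pd1 (pd1 (ψ T)) (x - y))
    - (∫ y : ℝ × ℝ, (F y * G y) * pd1 (pd1 (ψ T)) (x - y))
    + 2 * (∫ y : ℝ × ℝ, (F y * pd1 G y) * pd1 (ψ T) (x - y))
    - (∫ y : ℝ × ℝ, (F y * pd1 (pd1 G) y) * ψ T (x - y))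

section Kernel

theorem pd1_schwartz (φ : SchwartzMap (ℝ × ℝ) ℝ) :
    ∃ χ : SchwartzMap (ℝ × ℝ) ℝ, pd1 φ = ⇑χ := by
  refine ⟨SchwartzMap.evalCLM ℝ (ℝ × ℝ) ℝ (1, 0) (SchwartzMap.fderivCLM ℝ (ℝ × ℝ) ℝ φ), ?_⟩
  funext x
  have h1 : HasFDerivAt φ (fderiv ℝ φ x) (x.1, x.2) := φ.differentiableAt.hasFDerivAt
  have h2 : HasDerivAt (fun s : ℝ => (s, x.2)) ((1 : ℝ), (0 : ℝ)) x.1 :=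
    (hasDerivAt_id x.1).prodMk (hasDerivAt_const x.1 x.2)
  have h3 := h1.comp_hasDerivAt x.1 h2
  exact h3.deriv

theorem hasDerivAt_schwartz_fst (φ : SchwartzMap (ℝ × ℝ) ℝ) (s t : ℝ) :
    HasDerivAt (fun s : ℝ => φ (s, t)) (pd1 φ (s, t)) s := by
  have h : Differentiable ℝ (fun s : ℝ => φ (s, t)) :=
    φ.differentiable.comp (differentiable_id.prodMk (differentiable_const t))
  exact (h s).hasDerivAt

theorem schwartz_decay (φ : SchwartzMap (ℝ × ℝ) ℝ) (n : ℕ) :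
    ∃ M : ℝ, 0 ≤ M ∧ ∀ z, (1 + ‖z‖) ^ n * |φ z| ≤ M := by
  refine ⟨2 ^ n * (Finset.Iic (n, 0)).sup (fun m => SchwartzMap.seminorm ℝ m.1 m.2) φ, ?_, ?_⟩
  · positivity
  · intro z
    simpa using SchwartzMap.one_add_le_sup_seminorm_apply (𝕜 := ℝ) (m := (n, 0))
      (le_refl n) (le_refl 0) φ z

/-- The parabolic dilation `(x₁, x₂) ↦ (a x₁, a² x₂)`. -/
def pdil (a : ℝ) (x : ℝ × ℝ) : ℝ × ℝ := (a * x.1, a ^ 2 * x.2)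

theorem pdil_sub (a : ℝ) (x y : ℝ × ℝ) : pdil a x - pdil a y = pdil a (x - y) := by
  simp [pdil, mul_sub]

theorem continuous_pdil (a : ℝ) : Continuous (pdil a) := by
  unfold pdil; fun_prop

theorem pdil_pdil_inv {a : ℝ} (ha : a ≠ 0) (x : ℝ × ℝ) : pdil a (pdil a⁻¹ x) = x := by
  ext <;> simp [pdil] <;> field_simp

theorem pdil_inv_pdil {a : ℝ} (ha : a ≠ 0) (x : ℝ × ℝ) : pdil a⁻¹ (pdil a x) = x := by
  ext <;> simp [pdil] <;> field_simp

theorem map_pdil_volume {a : ℝ} (ha : 0 < a) :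
    Measure.map (pdil a) volume = ENNReal.ofReal (a ^ 3)⁻¹ • (volume : Measure (ℝ × ℝ)) := by
  have h1 : pdil a = Prod.map (fun t : ℝ => a * t) (fun t : ℝ => a ^ 2 * t) := rfl
  rw [h1, Measure.volume_eq_prod, ← Measure.map_prod_map _ _ (by fun_prop) (by fun_prop),
    Real.map_volume_mul_left ha.ne', Real.map_volume_mul_left (pow_pos ha 2).ne',
    Measure.prod_smul_left, Measure.prod_smul_right, smul_smul,
    ← ENNReal.ofReal_mul (abs_nonneg _), abs_of_pos (inv_pos.2 ha),
    abs_of_pos (inv_pos.2 (pow_pos ha 2))]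
  congr 2
  field_simp

theorem integral_comp_pdil {E : Type*} [NormedAddCommGroup E] [NormedSpace ℝ E] {a : ℝ}
    (ha : 0 < a) (f : ℝ × ℝ → E) : ∫ y, f y = a ^ 3 • ∫ y, f (pdil a y) := by
  have he : MeasurableEmbedding (pdil a) :=
    (MeasurableEquiv.mk ⟨pdil a, pdil a⁻¹, pdil_inv_pdil ha.ne', pdil_pdil_inv ha.ne'⟩
      (continuous_pdil a).measurable (continuous_pdil a⁻¹).measurable).measurableEmbedding
  rw [← he.integral_map, map_pdil_volume ha, integral_smul_measure,
    ENNReal.toReal_ofReal (by positivity), smul_smul, mul_inv_cancel₀ (by positivity), one_smul]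

theorem integrable_comp_pdil {a : ℝ} (ha : 0 < a) {f : ℝ × ℝ → ℝ} (hf : Integrable f) :
    Integrable (fun y => f (pdil a y)) := by
  refine Integrable.comp_measurable (g := f) ?_ (continuous_pdil a).measurable
  rw [map_pdil_volume ha]
  exact hf.smul_measure ENNReal.ofReal_ne_top

theorem eq_zero_of_fourier_eq_zero {h : ℝ × ℝ → ℝ} (hc : Continuous h) (hi : Integrable h)
    (hF : ∀ k : ℝ × ℝ, ∫ x : ℝ × ℝ,
      Complex.exp (-(2 * Real.pi * (k.1 * x.1 + k.2 * x.2) : ℝ) * Complex.I) * (h x : ℂ) = 0) :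
    h = 0 := by
  let e := MeasurableEquiv.toLp 2 (ℝ × ℝ)
  let g : WithLp 2 (ℝ × ℝ) → ℂ := fun z => (h z.ofLp : ℂ)
  have hmp := WithLp.volume_preserving_ofLp ℝ ℝ
  have hemb : MeasurableEmbedding (@WithLp.ofLp 2 (ℝ × ℝ)) := e.symm.measurableEmbedding
  have hgc : Continuous g :=
    Complex.continuous_ofReal.comp (hc.comp (WithLp.prod_continuous_ofLp 2 ℝ ℝ))
  have hgi : Integrable g := (hmp.integrable_comp_emb hemb).2 hi.ofReal
  have hFg : FourierTransform.fourier g = 0 := by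
    funext w
    rw [Real.fourier_eq', Pi.zero_apply, ← hF w.ofLp, ← hmp.integral_comp hemb]
    refine integral_congr_ae (Filter.Eventually.of_forall fun z => ?_)
    simp only [g, smul_eq_mul, WithLp.prod_inner_apply]
    congr 2
    simp
  have h2 := hgc.fourierInv_fourier_eq hgi (by rw [hFg]; exact integrable_zero _ _ _)
  rw [hFg] at h2
  have h3 : g = 0 := by
    rw [← h2]
    funext w
    simp [Real.fourierInv_eq']
  funext x
  have := congrFun h3 (WithLp.toLp 2 x)
  simpa [g] using this

theorem IsPsiKernel.comp_pdil {ψ : ℝ → ℝ × ℝ → ℝ} (hψ : IsPsiKernel ψ) {a : ℝ} (ha : 0 < a)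
    (z : ℝ × ℝ) : ψ (a ^ 4) (pdil a z) = (a ^ 3)⁻¹ * ψ 1 z := by
  obtain ⟨hS, ⟨C, hC⟩, -⟩ := hψ
  obtain ⟨φ, hφ⟩ := hS (a ^ 4) (by positivity)
  obtain ⟨χ, hχ⟩ := hS 1 one_pos
  have hfi : Integrable (fun y => a ^ 3 * ψ (a ^ 4) (pdil a y)) := by
    rw [hφ]; exact (integrable_comp_pdil ha φ.integrable).const_mul _
  have hgi : Integrable (ψ 1) := by rw [hχ]; exact χ.integrable
  have key : (fun y => a ^ 3 * ψ (a ^ 4) (pdil a y) - ψ 1 y) = 0 := by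
    refine eq_zero_of_fourier_eq_zero ?_ (hfi.sub hgi) fun k => ?_
    · rw [hφ, hχ]
      exact (continuous_const.mul (φ.continuous.comp (continuous_pdil a))).sub χ.continuous
    have hexp : ∀ {f : ℝ × ℝ → ℝ}, Integrable f → Integrable (fun x : ℝ × ℝ =>
        Complex.exp (-(2 * Real.pi * (k.1 * x.1 + k.2 * x.2) : ℝ) * Complex.I) * (f x : ℂ)) := by
      intro f hf
      refine hf.ofReal.bdd_mul (c := 1) ?_ (Filter.Eventually.of_forall fun x => ?_)
      · exact Continuous.aestronglyMeasurable (by fun_prop)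
      · rw [← Complex.ofReal_neg, Complex.norm_exp_ofReal_mul_I]
    have h1 := hC 1 one_pos k
    have h2 := hC (a ^ 4) (by positivity) (pdil a⁻¹ k)
    rw [integral_comp_pdil ha] at h2
    have h3 := integral_sub (hexp hfi) (hexp hgi)
    simp only [Complex.ofReal_sub, mul_sub]
    rw [h3, h1, sub_eq_zero]
    have h4 : a ^ 4 * ((pdil a⁻¹ k).1 ^ 4 + (pdil a⁻¹ k).2 ^ 2) = 1 * (k.1 ^ 4 + k.2 ^ 2) := by
      simp only [pdil]; field_simp
    rw [h4] at h2
    rw [← h2, ← integral_smul]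
    refine integral_congr_ae (Filter.Eventually.of_forall fun y => ?_)
    have h5 : (pdil a⁻¹ k).1 * (pdil a y).1 + (pdil a⁻¹ k).2 * (pdil a y).2
        = k.1 * y.1 + k.2 * y.2 := by
      simp only [pdil]; field_simp
    simp only [h5, Complex.real_smul]
    push_cast
    ring
  have := congrFun key z
  simp only [Pi.zero_apply, sub_eq_zero] at this
  rw [← this]
  field_simp

theorem pd1_comp_pdil (f : ℝ × ℝ → ℝ) (a : ℝ) (z : ℝ × ℝ) :
    pd1 (fun y => f (pdil a y)) z = a * pd1 f (pdil a z) := by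
  simp only [pd1, pdil]
  exact deriv_comp_mul_left a (fun s => f (s, a ^ 2 * z.2)) z.1

theorem pd1_const_mul (f : ℝ × ℝ → ℝ) (c : ℝ) : pd1 (fun y => c * f y) = fun z => c * pd1 f z := by
  funext z
  simp only [pd1]
  exact deriv_const_mul_field c

theorem commT_pdil {ψ : ℝ → ℝ × ℝ → ℝ} (hψ : IsPsiKernel ψ) {a : ℝ} (ha : 0 < a)
    (F G : ℝ × ℝ → ℝ) (x : ℝ × ℝ) :
    commT ψ (a ^ 4) F G (pdil a x)
      = (a ^ 2)⁻¹ * commT ψ 1 (fun y => F (pdil a y)) (fun y => G (pdil a y)) x := by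
  have e0 := funext fun z => hψ.comp_pdil ha z
  have e1 : ∀ z, pd1 (ψ (a ^ 4)) (pdil a z) = (a ^ 4)⁻¹ * pd1 (ψ 1) z := by
    intro z
    have := pd1_comp_pdil (ψ (a ^ 4)) a z
    rw [e0, pd1_const_mul] at this
    field_simp at this ⊢
    linarith
  have e2 : ∀ z, pd1 (pd1 (ψ (a ^ 4))) (pdil a z) = (a ^ 5)⁻¹ * pd1 (pd1 (ψ 1)) z := by
    intro z
    have := pd1_comp_pdil (pd1 (ψ (a ^ 4))) a z
    rw [funext e1, pd1_const_mul] at this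
    field_simp at this ⊢
    linarith
  have g1 : ∀ y, pd1 G (pdil a y) = a⁻¹ * pd1 (fun y => G (pdil a y)) y := by
    intro y; rw [pd1_comp_pdil]; field_simp
  have g2 : ∀ y, pd1 (pd1 G) (pdil a y) = (a ^ 2)⁻¹ * pd1 (pd1 (fun y => G (pdil a y))) y := by
    intro y
    have h : pd1 (fun y => G (pdil a y)) = fun y => a * pd1 G (pdil a y) :=
      funext (pd1_comp_pdil G a)
    rw [h, pd1_const_mul]
    simp only [pd1_comp_pdil]
    field_simp
  have hk : ∀ {f : ℝ × ℝ → ℝ} {g : ℝ × ℝ → ℝ}, (∀ y, a ^ 3 * f (pdil a y) = (a ^ 2)⁻¹ * g y) →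
      ∫ y, f y = (a ^ 2)⁻¹ * ∫ y, g y := by
    intro f g hfg
    rw [integral_comp_pdil ha, smul_eq_mul, ← integral_const_mul, ← integral_const_mul]
    simp only [hfg]
  have i1 : ∫ y, F y * pd1 (pd1 (ψ (a ^ 4))) (pdil a x - y)
      = (a ^ 2)⁻¹ * ∫ y, F (pdil a y) * pd1 (pd1 (ψ 1)) (x - y) :=
    hk fun y => by rw [pdil_sub, e2]; field_simp
  have i2 : ∫ y, (F y * G y) * pd1 (pd1 (ψ (a ^ 4))) (pdil a x - y)
      = (a ^ 2)⁻¹ * ∫ y, (F (pdil a y) * G (pdil a y)) * pd1 (pd1 (ψ 1)) (x - y) :=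
    hk fun y => by rw [pdil_sub, e2]; field_simp
  have i3 : ∫ y, (F y * pd1 G y) * pd1 (ψ (a ^ 4)) (pdil a x - y)
      = (a ^ 2)⁻¹ * ∫ y, (F (pdil a y) * pd1 (fun y => G (pdil a y)) y) * pd1 (ψ 1) (x - y) :=
    hk fun y => by rw [pdil_sub, e1, g1]; field_simp
  have i4 : ∫ y, (F y * pd1 (pd1 G) y) * ψ (a ^ 4) (pdil a x - y)
      = (a ^ 2)⁻¹ *
        ∫ y, (F (pdil a y) * pd1 (pd1 (fun y => G (pdil a y))) y) * ψ 1 (x - y) :=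
    hk fun y => by rw [pdil_sub, hψ.comp_pdil ha, g2]; field_simp
  simp only [commT]
  rw [i1, i2, i3, i4]
  ring

end Kernel

section Weight

/-- The time weight controlling `|∂₁ᵏ G|`, `k = 0, 1, 2`. -/
noncomputable def timeWeight (α t : ℝ) : ℝ := 1 + |t| ^ ((α - 1) / 2) + |t| ^ ((α - 2) / 2)

theorem one_le_timeWeight (α t : ℝ) : 1 ≤ timeWeight α t := by
  have := Real.rpow_nonneg (abs_nonneg t) ((α - 1) / 2)
  have := Real.rpow_nonneg (abs_nonneg t) ((α - 2) / 2)
  unfold timeWeight; linarith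

theorem rpow_one_le_timeWeight (α t : ℝ) : |t| ^ ((α - 1) / 2) ≤ timeWeight α t := by
  have := Real.rpow_nonneg (abs_nonneg t) ((α - 2) / 2)
  unfold timeWeight; linarith

theorem rpow_two_le_timeWeight (α t : ℝ) : |t| ^ ((α - 2) / 2) ≤ timeWeight α t := by
  have := Real.rpow_nonneg (abs_nonneg t) ((α - 1) / 2)
  unfold timeWeight; linarith

theorem measurable_timeWeight (α : ℝ) : Measurable (timeWeight α) := by
  unfold timeWeight; fun_prop

theorem integrable_abs_rpow_truncated {r : ℝ} (hr : -1 < r) (hr0 : r < 0) :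
    Integrable (fun t : ℝ => if |t| ≤ 1 then |t| ^ r else 0) := by
  have h1 : IntegrableOn (fun t : ℝ => t ^ r) (Set.Ioc 0 1) :=
    (intervalIntegrable_iff_integrableOn_Ioc_of_le zero_le_one).1
      (intervalIntegral.intervalIntegrable_rpow' hr)
  have h2 := (integrable_indicator_iff measurableSet_Ioc).2 h1
  refine (h2.add h2.comp_neg).congr (Filter.Eventually.of_forall fun t => ?_)
  simp only [Pi.add_apply, Set.indicator, Set.mem_Ioc]
  rcases lt_trichotomy t 0 with ht | ht | ht
  · rw [if_neg (by intro h; linarith [h.1]), abs_of_neg ht, zero_add]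
    simp [ht]
  · subst ht; simp [hr0.ne]
  · rw [if_neg (c := 0 < -t ∧ -t ≤ 1) (by intro h; linarith [h.1]), abs_of_pos ht, add_zero]
    simp [ht]

theorem timeWeight_convolution_bound {α : ℝ} (hα : 0 < α) (hα1 : α < 1) :
    ∃ K : ℝ, ∀ s : ℝ, Integrable (fun t => timeWeight α t * (1 + (s - t) ^ 2)⁻¹) ∧
      ∫ t, timeWeight α t * (1 + (s - t) ^ 2)⁻¹ ≤ K := by
  have hA := integrable_abs_rpow_truncated (r := (α - 1) / 2) (by linarith) (by linarith)
  have hB := integrable_abs_rpow_truncated (r := (α - 2) / 2) (by linarith) (by linarith)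
  have hAB := hA.add hB
  refine ⟨3 * Real.pi + ∫ t, ((fun t : ℝ => if |t| ≤ 1 then |t| ^ ((α - 1) / 2) else 0)
    + fun t : ℝ => if |t| ≤ 1 then |t| ^ ((α - 2) / 2) else 0) t, fun s => ?_⟩
  have hq : Integrable (fun t : ℝ => 3 * (1 + (s - t) ^ 2)⁻¹) :=
    (integrable_inv_one_add_sq.comp_sub_left s).const_mul 3
  have hmaj := hq.add hAB
  have hle : ∀ t : ℝ, timeWeight α t * (1 + (s - t) ^ 2)⁻¹ ≤ 3 * (1 + (s - t) ^ 2)⁻¹ +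
      ((fun t : ℝ => if |t| ≤ 1 then |t| ^ ((α - 1) / 2) else 0)
        + fun t : ℝ => if |t| ≤ 1 then |t| ^ ((α - 2) / 2) else 0) t := by
    intro t
    have q0 : 0 < (1 + (s - t) ^ 2)⁻¹ := by positivity
    have q1 : (1 + (s - t) ^ 2)⁻¹ ≤ 1 := inv_le_one_of_one_le₀ (by nlinarith [sq_nonneg (s - t)])
    have n1 := Real.rpow_nonneg (abs_nonneg t) ((α - 1) / 2)
    have n2 := Real.rpow_nonneg (abs_nonneg t) ((α - 2) / 2)
    simp only [Pi.add_apply, timeWeight]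
    split_ifs with ht
    · nlinarith
    · have l1 := Real.rpow_le_one_of_one_le_of_nonpos (not_le.1 ht).le
        (show (α - 1) / 2 ≤ 0 by linarith)
      have l2 := Real.rpow_le_one_of_one_le_of_nonpos (not_le.1 ht).le
        (show (α - 2) / 2 ≤ 0 by linarith)
      nlinarith
  have hnn : ∀ t : ℝ, 0 ≤ timeWeight α t * (1 + (s - t) ^ 2)⁻¹ := fun t =>
    mul_nonneg (zero_le_one.trans (one_le_timeWeight α t)) (by positivity)
  have hint : Integrable (fun t => timeWeight α t * (1 + (s - t) ^ 2)⁻¹) := by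
    refine hmaj.mono' ?_ (Filter.Eventually.of_forall fun t => ?_)
    · exact ((measurable_timeWeight α).mul (by fun_prop)).aestronglyMeasurable
    · rw [Real.norm_of_nonneg (hnn t)]; exact hle t
  refine ⟨hint, (integral_mono hint hmaj hle).trans ?_⟩
  rw [integral_add' hq hAB, integral_const_mul,
    integral_sub_left_eq_self (fun t : ℝ => (1 + t ^ 2)⁻¹) volume s, integral_univ_inv_one_add_sq]

/-- Schwartz kernels integrate functions of at most quadratic growth with an integrable
singularity in time, uniformly in the base point. -/
theorem integral_mul_kernel_bound {α : ℝ} (hα : 0 < α) (hα1 : α < 1)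
    (k : SchwartzMap (ℝ × ℝ) ℝ) :
    ∃ K : ℝ, 0 ≤ K ∧ ∀ (x : ℝ × ℝ) (c : ℝ) (g : ℝ × ℝ → ℝ), AEStronglyMeasurable g →
      (∀ᵐ y : ℝ × ℝ, |g y| ≤ c * (timeWeight α y.2 * (1 + ‖x - y‖) ^ 2)) →
      Integrable (fun y => g y * k (x - y)) ∧ |∫ y, g y * k (x - y)| ≤ c * K := by
  obtain ⟨M, hM0, hM⟩ := schwartz_decay k 6
  obtain ⟨K, hK⟩ := timeWeight_convolution_bound hα hα1
  have hK0 : 0 ≤ K := le_trans (integral_nonneg fun t =>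
    mul_nonneg (zero_le_one.trans (one_le_timeWeight α t)) (by positivity)) (hK 0).2
  refine ⟨M * (Real.pi * K), by positivity, fun x c g hg hgb => ?_⟩
  have hc : 0 ≤ c := by
    obtain ⟨y, hy⟩ := hgb.exists
    have h1 : 0 < timeWeight α y.2 * (1 + ‖x - y‖) ^ 2 :=
      mul_pos (zero_lt_one.trans_le (one_le_timeWeight α _)) (by positivity)
    exact nonneg_of_mul_nonneg_left ((abs_nonneg _).trans hy) h1
  have hmaj : Integrable (fun y : ℝ × ℝ => c * M * ((1 + (x.1 - y.1) ^ 2)⁻¹ *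
      (timeWeight α y.2 * (1 + (x.2 - y.2) ^ 2)⁻¹))) :=
    (Integrable.mul_prod (integrable_inv_one_add_sq.comp_sub_left x.1) (hK x.2).1).const_mul _
  have hle : ∀ᵐ y : ℝ × ℝ, ‖g y * k (x - y)‖ ≤ c * M * ((1 + (x.1 - y.1) ^ 2)⁻¹ *
      (timeWeight α y.2 * (1 + (x.2 - y.2) ^ 2)⁻¹)) := by
    filter_upwards [hgb] with y hy
    have hw := zero_le_one.trans (one_le_timeWeight α y.2)
    have hn := norm_nonneg (x - y)
    have n1 : |x.1 - y.1| ≤ ‖x - y‖ := norm_fst_le (x - y)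
    have n2 : |x.2 - y.2| ≤ ‖x - y‖ := norm_snd_le (x - y)
    have s1 : 1 + (x.1 - y.1) ^ 2 ≤ (1 + ‖x - y‖) ^ 2 := by
      nlinarith [sq_abs (x.1 - y.1), abs_nonneg (x.1 - y.1)]
    have s2 : 1 + (x.2 - y.2) ^ 2 ≤ (1 + ‖x - y‖) ^ 2 := by
      nlinarith [sq_abs (x.2 - y.2), abs_nonneg (x.2 - y.2)]
    have hk : (1 + ‖x - y‖) ^ 2 * |k (x - y)|
        ≤ M * ((1 + (x.1 - y.1) ^ 2)⁻¹ * (1 + (x.2 - y.2) ^ 2)⁻¹) := by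
      rw [← mul_inv, ← div_eq_mul_inv, le_div_iff₀ (by positivity)]
      refine le_trans ?_ (hM (x - y))
      calc (1 + ‖x - y‖) ^ 2 * |k (x - y)| * ((1 + (x.1 - y.1) ^ 2) * (1 + (x.2 - y.2) ^ 2))
          ≤ (1 + ‖x - y‖) ^ 2 * |k (x - y)| * ((1 + ‖x - y‖) ^ 2 * (1 + ‖x - y‖) ^ 2) := by
            gcongr
        _ = _ := by ring
    rw [norm_mul, Real.norm_eq_abs, Real.norm_eq_abs]
    calc |g y| * |k (x - y)|
        ≤ c * (timeWeight α y.2 * (1 + ‖x - y‖) ^ 2) * |k (x - y)| := by gcongr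
      _ = c * timeWeight α y.2 * ((1 + ‖x - y‖) ^ 2 * |k (x - y)|) := by ring
      _ ≤ c * timeWeight α y.2 *
          (M * ((1 + (x.1 - y.1) ^ 2)⁻¹ * (1 + (x.2 - y.2) ^ 2)⁻¹)) := by gcongr
      _ = _ := by ring
  have hkm : AEStronglyMeasurable (fun y => k (x - y)) :=
    (k.continuous.comp (continuous_const.sub continuous_id)).aestronglyMeasurable
  refine ⟨hmaj.mono' (hg.mul hkm) hle, (norm_integral_le_of_norm_le hmaj hle).trans ?_⟩
  rw [integral_const_mul, Measure.volume_eq_prod,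
    integral_prod_mul (fun s => (1 + (x.1 - s) ^ 2)⁻¹)
      (fun t => timeWeight α t * (1 + (x.2 - t) ^ 2)⁻¹),
    integral_sub_left_eq_self (fun t : ℝ => (1 + t ^ 2)⁻¹) volume x.1,
    integral_univ_inv_one_add_sq, mul_assoc]
  have := (hK x.2).2
  gcongr

end Weight

section Commutator

theorem pdist_nonneg (x y : ℝ × ℝ) : 0 ≤ pdist x y := by unfold pdist; positivity

theorem pdist_rpow_le {α : ℝ} (hα : 0 < α) (hα1 : α < 1) (x y : ℝ × ℝ) :
    pdist x y ^ α ≤ 2 * (1 + ‖x - y‖) := by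
  have hn := norm_nonneg (x - y)
  have n1 : |x.1 - y.1| ≤ ‖x - y‖ := norm_fst_le (x - y)
  have n2 : |x.2 - y.2| ≤ ‖x - y‖ := norm_snd_le (x - y)
  have n3 : √|x.2 - y.2| ≤ 1 + ‖x - y‖ := Real.sqrt_le_iff.2 ⟨by positivity, by nlinarith⟩
  have h : pdist x y ≤ 2 * (1 + ‖x - y‖) := by unfold pdist; linarith
  calc pdist x y ^ α ≤ (2 * (1 + ‖x - y‖)) ^ α := by
        gcongr; exact pdist_nonneg x y
    _ ≤ (2 * (1 + ‖x - y‖)) ^ (1 : ℝ) :=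
        Real.rpow_le_rpow_of_exponent_le (by linarith) hα1.le
    _ = _ := Real.rpow_one _

theorem pdist_pdil {a : ℝ} (ha : 0 ≤ a) (x y : ℝ × ℝ) :
    pdist (pdil a x) (pdil a y) = a * pdist x y := by
  simp only [pdist, pdil, ← mul_sub, abs_mul, abs_of_nonneg ha, abs_pow]
  rw [Real.sqrt_mul (by positivity), Real.sqrt_sq ha]
  ring

theorem nonneg_of_holder {α A : ℝ} {f : ℝ × ℝ → ℝ}
    (hf : ∀ x y : ℝ × ℝ, |f x - f y| ≤ A * pdist x y ^ α) : 0 ≤ A := by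
  have h := (abs_nonneg _).trans (hf (1, 0) (0, 0))
  simpa [pdist] using h

theorem continuous_of_holder {α A : ℝ} (hα : 0 < α) {f : ℝ × ℝ → ℝ}
    (hf : ∀ x y : ℝ × ℝ, |f x - f y| ≤ A * pdist x y ^ α) : Continuous f := by
  refine continuous_iff_continuousAt.2 fun x => ?_
  have hc : Continuous fun y : ℝ × ℝ => A * pdist y x ^ α := by
    unfold pdist
    exact continuous_const.mul ((by fun_prop : Continuous fun y : ℝ × ℝ =>
      |y.1 - x.1| + √|y.2 - x.2|).rpow_const fun _ => Or.inr hα.le)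
  have h0 : Filter.Tendsto (fun y : ℝ × ℝ => A * pdist y x ^ α) (nhds x) (nhds 0) := by
    have := hc.tendsto x
    simpa [pdist, Real.zero_rpow hα.ne'] using this
  rw [ContinuousAt, tendsto_iff_dist_tendsto_zero]
  exact squeeze_zero (fun _ => dist_nonneg) (fun y => hf y x) h0

/-- `G` is parabolically `α`-Hölder, and twice differentiable in the first variable off
`{x₂ = 0}` with the natural blow-up rates. -/
structure IsAdmissible (α A C : ℝ) (G : ℝ × ℝ → ℝ) : Prop where
  holder : ∀ x y : ℝ × ℝ, |G x - G y| ≤ A * pdist x y ^ α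
  diff : ∀ x : ℝ × ℝ, x.2 ≠ 0 → DifferentiableAt ℝ (fun s : ℝ => G (s, x.2)) x.1
  diff_pd1 : ∀ x : ℝ × ℝ, x.2 ≠ 0 → DifferentiableAt ℝ (fun s : ℝ => pd1 G (s, x.2)) x.1
  pd1_le : ∀ x : ℝ × ℝ, x.2 ≠ 0 → |pd1 G x| ≤ C * |x.2| ^ ((α - 1) / 2)
  pd1_pd1_le : ∀ x : ℝ × ℝ, x.2 ≠ 0 → |pd1 (pd1 G) x| ≤ C * |x.2| ^ ((α - 2) / 2)

theorem ae_snd_ne_zero : ∀ᵐ y : ℝ × ℝ, y.2 ≠ 0 := by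
  have h : ∀ᵐ t : ℝ, t ≠ 0 := Measure.ae_ne volume 0
  exact Measure.quasiMeasurePreserving_snd.ae h

theorem measurable_pd1 {G : ℝ × ℝ → ℝ} (hG : Continuous G) : Measurable (pd1 G) := by
  have h : Continuous (Function.uncurry fun (t s : ℝ) => G (s, t)) := by
    exact hG.comp continuous_swap
  exact (measurable_deriv_with_param h).comp measurable_swap

namespace IsAdmissible

variable {α A C : ℝ} {G : ℝ × ℝ → ℝ}

theorem nonneg_right (h : IsAdmissible α A C G) : 0 ≤ C := by
  have := (abs_nonneg _).trans (h.pd1_le (0, 1) one_ne_zero)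
  simpa using this

theorem hasDerivAt (h : IsAdmissible α A C G) (s : ℝ) {t : ℝ} (ht : t ≠ 0) :
    HasDerivAt (fun s => G (s, t)) (pd1 G (s, t)) s :=
  (h.diff (s, t) ht).hasDerivAt

theorem hasDerivAt_pd1 (h : IsAdmissible α A C G) (s : ℝ) {t : ℝ} (ht : t ≠ 0) :
    HasDerivAt (fun s => pd1 G (s, t)) (pd1 (pd1 G) (s, t)) s :=
  (h.diff_pd1 (s, t) ht).hasDerivAt

theorem aestronglyMeasurable_pd1_pd1 (hα : 0 < α) (h : IsAdmissible α A C G) :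
    AEStronglyMeasurable (pd1 (pd1 G)) := by
  have hm := measurable_pd1 (continuous_of_holder hα h.holder)
  have hlim : ∀ᵐ y : ℝ × ℝ, Filter.Tendsto
      (fun n : ℕ => (n + 1 : ℝ) * (pd1 G (y.1 + 1 / ((n : ℝ) + 1), y.2) - pd1 G y))
      Filter.atTop (nhds (pd1 (pd1 G) y)) := by
    filter_upwards [ae_snd_ne_zero] with y hy
    have h1 := (h.hasDerivAt_pd1 y.1 hy).tendsto_slope_zero_right
    have h2 : Filter.Tendsto (fun n : ℕ => 1 / ((n : ℝ) + 1)) Filter.atTop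
        (nhdsWithin 0 (Set.Ioi 0)) :=
      tendsto_nhdsWithin_iff.2 ⟨tendsto_one_div_add_atTop_nhds_zero_nat,
        Filter.Eventually.of_forall fun n => by simp only [Set.mem_Ioi]; positivity⟩
    refine (h1.comp h2).congr fun n => ?_
    simp
  refine (aemeasurable_of_tendsto_metrizable_ae Filter.atTop (fun n => ?_)
    hlim).aestronglyMeasurable
  exact (((hm.comp (by fun_prop)).sub hm).const_mul _).aemeasurable

theorem sub {A' C' B D : ℝ} {G' : ℝ × ℝ → ℝ} (h : IsAdmissible α A C G)
    (h' : IsAdmissible α A' C' G')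
    (hB : ∀ x y : ℝ × ℝ, |(G x - G' x) - (G y - G' y)| ≤ B * pdist x y ^ α)
    (h1 : ∀ x : ℝ × ℝ, x.2 ≠ 0 → |pd1 G x - pd1 G' x| ≤ D * |x.2| ^ ((α - 1) / 2))
    (h2 : ∀ x : ℝ × ℝ, x.2 ≠ 0 →
      |pd1 (pd1 G) x - pd1 (pd1 G') x| ≤ D * |x.2| ^ ((α - 2) / 2)) :
    IsAdmissible α B D (fun x => G x - G' x) ∧
      (∀ x : ℝ × ℝ, x.2 ≠ 0 → pd1 (fun x => G x - G' x) x = pd1 G x - pd1 G' x) ∧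
      (∀ x : ℝ × ℝ, x.2 ≠ 0 →
        pd1 (pd1 (fun x => G x - G' x)) x = pd1 (pd1 G) x - pd1 (pd1 G') x) := by
  have e1 : ∀ (s : ℝ) {t : ℝ}, t ≠ 0 →
      pd1 (fun x => G x - G' x) (s, t) = pd1 G (s, t) - pd1 G' (s, t) := fun s t ht =>
    ((h.hasDerivAt s ht).sub (h'.hasDerivAt s ht)).deriv
  have d2 : ∀ x : ℝ × ℝ, x.2 ≠ 0 → HasDerivAt (fun s => pd1 (fun x => G x - G' x) (s, x.2))
      (pd1 (pd1 G) x - pd1 (pd1 G') x) x.1 := fun x hx => by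
    simp only [e1 _ hx]
    exact (h.hasDerivAt_pd1 x.1 hx).sub (h'.hasDerivAt_pd1 x.1 hx)
  have e2 : ∀ x : ℝ × ℝ, x.2 ≠ 0 →
      pd1 (pd1 (fun x => G x - G' x)) x = pd1 (pd1 G) x - pd1 (pd1 G') x := fun x hx =>
    (d2 x hx).deriv
  refine ⟨⟨hB, fun x hx => (h.diff x hx).sub (h'.diff x hx), fun x hx =>
    (d2 x hx).differentiableAt, fun x hx => ?_, fun x hx => ?_⟩, fun x hx => e1 x.1 hx, e2⟩
  · rw [show pd1 (fun x => G x - G' x) x = pd1 G x - pd1 G' x from e1 x.1 hx]; exact h1 x hx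
  · rw [e2 x hx]; exact h2 x hx

theorem comp_pdil (h : IsAdmissible α A C G) {a : ℝ} (ha : 0 < a) :
    IsAdmissible α (A * a ^ α) (C * a ^ α) (fun y => G (pdil a y)) := by
  have hp : ∀ x : ℝ × ℝ, x.2 ≠ 0 → (pdil a x).2 ≠ 0 := fun x hx =>
    mul_ne_zero (by positivity) hx
  have e1 : pd1 (fun y => G (pdil a y)) = fun y => a * pd1 G (pdil a y) :=
    funext (pd1_comp_pdil G a)
  have e2 : pd1 (pd1 (fun y => G (pdil a y))) = fun y => a ^ 2 * pd1 (pd1 G) (pdil a y) := by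
    rw [e1, pd1_const_mul]
    funext y
    rw [pd1_comp_pdil (pd1 G)]; ring
  have hs : ∀ (x : ℝ × ℝ) (r : ℝ), |(pdil a x).2| ^ (r / 2) = a ^ r * |x.2| ^ (r / 2) := by
    intro x r
    simp only [pdil, abs_mul, abs_pow, abs_of_pos ha]
    rw [Real.mul_rpow (by positivity) (abs_nonneg _), ← Real.rpow_natCast a 2,
      ← Real.rpow_mul ha.le]
    congr 2; push_cast; ring
  refine ⟨fun x y => ?_, fun x hx => ?_, fun x hx => ?_, fun x hx => ?_, fun x hx => ?_⟩
  · refine (h.holder _ _).trans (le_of_eq ?_)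
    rw [pdist_pdil ha.le, Real.mul_rpow ha.le (pdist_nonneg x y)]; ring
  · exact (h.diff (pdil a x) (hp x hx)).comp (f := fun s : ℝ => a * s) x.1 (by fun_prop)
  · rw [e1]
    exact ((h.diff_pd1 (pdil a x) (hp x hx)).comp (f := fun s : ℝ => a * s) x.1
      (by fun_prop)).const_mul a
  · rw [e1, abs_mul, abs_of_pos ha]
    calc a * |pd1 G (pdil a x)| ≤ a * (C * |(pdil a x).2| ^ ((α - 1) / 2)) := by
          have := h.pd1_le _ (hp x hx); gcongr
      _ = C * (a * a ^ (α - 1)) * |x.2| ^ ((α - 1) / 2) := by rw [hs]; ring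
      _ = _ := by rw [Real.rpow_sub_one ha.ne']; field_simp
  · rw [e2, abs_mul, abs_of_pos (by positivity : (0 : ℝ) < a ^ 2)]
    calc a ^ 2 * |pd1 (pd1 G) (pdil a x)|
        ≤ a ^ 2 * (C * |(pdil a x).2| ^ ((α - 2) / 2)) := by
          have := h.pd1_pd1_le _ (hp x hx); gcongr
      _ = C * (a ^ 2 * a ^ (α - 2)) * |x.2| ^ ((α - 2) / 2) := by rw [hs]; ring
      _ = _ := by rw [Real.rpow_sub ha, Real.rpow_two]; field_simp

variable {x : ℝ × ℝ} {c : ℝ} {f : ℝ × ℝ → ℝ}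

theorem mul_sub_le_weight (hα : 0 < α) (hα1 : α < 1) (h : IsAdmissible α A C G)
    (hf : ∀ y, |f y| ≤ c * (2 * (1 + ‖x - y‖))) (y : ℝ × ℝ) :
    |f y * (G x - G y)| ≤ 4 * c * A * (timeWeight α y.2 * (1 + ‖x - y‖) ^ 2) := by
  have hA := nonneg_of_holder h.holder
  have hG : |G x - G y| ≤ A * (2 * (1 + ‖x - y‖)) :=
    (h.holder x y).trans (by have := pdist_rpow_le hα hα1 x y; gcongr)
  have hc : 0 ≤ c * (2 * (1 + ‖x - y‖)) := (abs_nonneg _).trans (hf y)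
  rw [abs_mul]
  calc |f y| * |G x - G y| ≤ c * (2 * (1 + ‖x - y‖)) * (A * (2 * (1 + ‖x - y‖))) :=
        mul_le_mul (hf y) hG (abs_nonneg _) hc
    _ = c * (2 * (1 + ‖x - y‖)) * (A * (2 * (1 + ‖x - y‖))) * 1 := by ring
    _ ≤ c * (2 * (1 + ‖x - y‖)) * (A * (2 * (1 + ‖x - y‖))) * timeWeight α y.2 :=
        mul_le_mul_of_nonneg_left (one_le_timeWeight α y.2) (by positivity)
    _ = _ := by ring

theorem mul_le_weight {D u t : ℝ} {y : ℝ × ℝ} (hD : 0 ≤ D)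
    (hf : |f y| ≤ c * (2 * (1 + ‖x - y‖))) (hu : |u| ≤ D * t) (ht : t ≤ timeWeight α y.2) :
    |f y * u| ≤ 2 * c * D * (timeWeight α y.2 * (1 + ‖x - y‖) ^ 2) := by
  have hc : 0 ≤ c * (2 * (1 + ‖x - y‖)) := (abs_nonneg _).trans hf
  have hw := zero_le_one.trans (one_le_timeWeight α y.2)
  rw [abs_mul]
  calc |f y| * |u| ≤ c * (2 * (1 + ‖x - y‖)) * (D * timeWeight α y.2) :=
        mul_le_mul hf (hu.trans (by gcongr)) (abs_nonneg _) hc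
    _ = c * (2 * (1 + ‖x - y‖)) * (D * timeWeight α y.2) * 1 := by ring
    _ ≤ c * (2 * (1 + ‖x - y‖)) * (D * timeWeight α y.2) * (1 + ‖x - y‖) :=
        mul_le_mul_of_nonneg_left (by linarith [norm_nonneg (x - y)]) (by positivity)
    _ = _ := by ring

theorem mul_pd1_le_weight (h : IsAdmissible α A C G)
    (hf : ∀ y, |f y| ≤ c * (2 * (1 + ‖x - y‖))) :
    ∀ᵐ y : ℝ × ℝ, |f y * pd1 G y| ≤ 2 * c * C * (timeWeight α y.2 * (1 + ‖x - y‖) ^ 2) := by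
  filter_upwards [ae_snd_ne_zero] with y hy
  exact mul_le_weight h.nonneg_right (hf y) (h.pd1_le y hy) (rpow_one_le_timeWeight α y.2)

theorem mul_pd1_pd1_le_weight (h : IsAdmissible α A C G)
    (hf : ∀ y, |f y| ≤ c * (2 * (1 + ‖x - y‖))) :
    ∀ᵐ y : ℝ × ℝ,
      |f y * pd1 (pd1 G) y| ≤ 2 * c * C * (timeWeight α y.2 * (1 + ‖x - y‖) ^ 2) := by
  filter_upwards [ae_snd_ne_zero] with y hy
  exact mul_le_weight h.nonneg_right (hf y) (h.pd1_pd1_le y hy) (rpow_two_le_timeWeight α y.2)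

end IsAdmissible

end Commutator

section Estimate

/-- The density of the renormalized commutator against `F`. -/
noncomputable def commDensity (φ G : ℝ × ℝ → ℝ) (x y : ℝ × ℝ) : ℝ :=
  (G x - G y) * pd1 (pd1 φ) (x - y) + 2 * (pd1 G y * pd1 φ (x - y)) - pd1 (pd1 G) y * φ (x - y)

theorem commDensity_bound {α : ℝ} (hα : 0 < α) (hα1 : α < 1) (φ : SchwartzMap (ℝ × ℝ) ℝ) :
    ∃ K : ℝ, ∀ (A C : ℝ) (G : ℝ × ℝ → ℝ), IsAdmissible α A C G →
      ∀ (x : ℝ × ℝ) (c : ℝ) (f : ℝ × ℝ → ℝ), Continuous f →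
      (∀ y, |f y| ≤ c * (2 * (1 + ‖x - y‖))) →
      Integrable (fun y => (f y * (G x - G y)) * pd1 (pd1 φ) (x - y)) ∧
      Integrable (fun y => (f y * pd1 G y) * pd1 φ (x - y)) ∧
      Integrable (fun y => (f y * pd1 (pd1 G) y) * φ (x - y)) ∧
      |∫ y, f y * commDensity φ G x y| ≤ K * (C + A) * c := by
  obtain ⟨φ₁, h₁⟩ := pd1_schwartz φ
  obtain ⟨φ₂, h₂⟩ := pd1_schwartz φ₁
  obtain ⟨K₀, hK₀, H₀⟩ := integral_mul_kernel_bound hα hα1 φ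
  obtain ⟨K₁, hK₁, H₁⟩ := integral_mul_kernel_bound hα hα1 φ₁
  obtain ⟨K₂, hK₂, H₂⟩ := integral_mul_kernel_bound hα hα1 φ₂
  refine ⟨4 * K₂ + 4 * K₁ + 2 * K₀, fun A C G hG x c f hf hfb => ?_⟩
  have hA := nonneg_of_holder hG.holder
  have hC := hG.nonneg_right
  have hc : 0 ≤ c := by
    have := (abs_nonneg _).trans (hfb x)
    simpa using this
  have hGc := continuous_of_holder hα hG.holder
  obtain ⟨i₂, b₂⟩ := H₂ x _ (fun y => f y * (G x - G y))
    (hf.mul (continuous_const.sub hGc)).aestronglyMeasurable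
    (Filter.Eventually.of_forall (hG.mul_sub_le_weight hα hα1 hfb))
  obtain ⟨i₁, b₁⟩ := H₁ x _ (fun y => f y * pd1 G y)
    (hf.aestronglyMeasurable.mul (measurable_pd1 hGc).aestronglyMeasurable)
    (hG.mul_pd1_le_weight hfb)
  obtain ⟨i₀, b₀⟩ := H₀ x _ (fun y => f y * pd1 (pd1 G) y)
    (hf.aestronglyMeasurable.mul (hG.aestronglyMeasurable_pd1_pd1 hα))
    (hG.mul_pd1_pd1_le_weight hfb)
  rw [h₁, h₂]
  refine ⟨i₂, i₁, i₀, ?_⟩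
  have e : ∫ y, f y * commDensity φ G x y = (∫ y, (f y * (G x - G y)) * φ₂ (x - y))
      + 2 * (∫ y, (f y * pd1 G y) * φ₁ (x - y)) - ∫ y, (f y * pd1 (pd1 G) y) * φ (x - y) := by
    have i₂₁ : Integrable (fun y => (f y * (G x - G y)) * φ₂ (x - y)
        + 2 * ((f y * pd1 G y) * φ₁ (x - y))) := i₂.add (i₁.const_mul 2)
    rw [← integral_const_mul, ← integral_add i₂ (i₁.const_mul 2), ← integral_sub i₂₁ i₀]
    refine integral_congr_ae (Filter.Eventually.of_forall fun y => ?_)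
    simp only [commDensity, h₁, h₂]
    ring
  rw [e, abs_le]
  rw [abs_le] at b₀ b₁ b₂
  have n1 : 0 ≤ c * A * K₁ := by positivity
  have n2 : 0 ≤ c * A * K₀ := by positivity
  have n3 : 0 ≤ c * C * K₂ := by positivity
  constructor <;> nlinarith

theorem commT_eq_integral_commDensity {α : ℝ} (hα : 0 < α) (hα1 : α < 1)
    {ψ : ℝ → ℝ × ℝ → ℝ} {T : ℝ} {φ : SchwartzMap (ℝ × ℝ) ℝ} (hφ : ψ T = ⇑φ)
    {A C B : ℝ} {F G : ℝ × ℝ → ℝ} (hG : IsAdmissible α A C G) (hF : Continuous F)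
    (hFB : ∀ x, |F x| ≤ B) (x : ℝ × ℝ) :
    Integrable (fun y => F y * commDensity φ G x y) ∧
      commT ψ T F G x = ∫ y, F y * commDensity φ G x y := by
  obtain ⟨K, hK⟩ := commDensity_bound hα hα1 φ
  obtain ⟨i₂, i₁, i₀, -⟩ := hK A C G hG x B F hF fun y => (hFB y).trans (by
    have hB := (abs_nonneg _).trans (hFB y)
    nlinarith [mul_nonneg hB (norm_nonneg (x - y))])
  obtain ⟨φ₁, h₁⟩ := pd1_schwartz φ
  obtain ⟨φ₂, h₂⟩ := pd1_schwartz φ₁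
  have j : Integrable (fun y => F y * pd1 (pd1 φ) (x - y)) := by
    rw [h₁, h₂]
    exact (φ₂.integrable.comp_sub_left x).bdd_mul (c := B) hF.aestronglyMeasurable
      (Filter.Eventually.of_forall hFB)
  have j' : Integrable (fun y => (F y * G y) * pd1 (pd1 φ) (x - y)) :=
    ((j.const_mul (G x)).sub i₂).congr (Filter.Eventually.of_forall fun y => by
      simp only [Pi.sub_apply]; ring)
  have e : ∀ y, F y * commDensity φ G x y = G x * (F y * pd1 (pd1 φ) (x - y))
      - (F y * G y) * pd1 (pd1 φ) (x - y) + 2 * ((F y * pd1 G y) * pd1 φ (x - y))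
      - (F y * pd1 (pd1 G) y) * φ (x - y) := fun y => by
    simp only [commDensity]; ring
  have k₂ : Integrable (fun y => G x * (F y * pd1 (pd1 φ) (x - y))
      - (F y * G y) * pd1 (pd1 φ) (x - y)) := (j.const_mul (G x)).sub j'
  have k₁ : Integrable (fun y => G x * (F y * pd1 (pd1 φ) (x - y))
      - (F y * G y) * pd1 (pd1 φ) (x - y) + 2 * ((F y * pd1 G y) * pd1 φ (x - y))) :=
    k₂.add (i₁.const_mul 2)
  simp only [e]
  refine ⟨k₁.sub i₀, ?_⟩
  rw [commT, hφ, ← integral_const_mul, ← integral_const_mul, ← integral_sub (j.const_mul _) j',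
    ← integral_add k₂ (i₁.const_mul 2), ← integral_sub k₁ i₀]

/-- For constant `F` the renormalized commutator vanishes: its density is the second
`x₁`-derivative of `y ↦ (G x - G y) φ (x - y)`. -/
theorem integral_commDensity_eq_zero {α : ℝ} (hα : 0 < α) (hα1 : α < 1)
    (φ : SchwartzMap (ℝ × ℝ) ℝ) {A C : ℝ} {G : ℝ × ℝ → ℝ} (hG : IsAdmissible α A C G)
    (x : ℝ × ℝ) : ∫ y, commDensity φ G x y = 0 := by
  obtain ⟨K, hK⟩ := commDensity_bound hα hα1 φ
  obtain ⟨φ₁, h₁⟩ := pd1_schwartz φ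
  obtain ⟨K₀, -, H₀⟩ := integral_mul_kernel_bound hα hα1 φ
  obtain ⟨K₁, -, H₁⟩ := integral_mul_kernel_bound hα hα1 φ₁
  have hb : ∀ y : ℝ × ℝ, |(fun _ => (1 : ℝ)) y| ≤ 1 * (2 * (1 + ‖x - y‖)) := fun y => by
    rw [abs_one]; linarith [norm_nonneg (x - y)]
  have hGc := continuous_of_holder hα hG.holder
  obtain ⟨i₂, i₁, i₀, -⟩ := hK A C G hG x 1 (fun _ => 1) continuous_const hb
  have hV₁ := (H₁ x _ (fun y => 1 * (G x - G y))
    (continuous_const.mul (continuous_const.sub hGc)).aestronglyMeasurable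
    (Filter.Eventually.of_forall (hG.mul_sub_le_weight hα hα1 hb))).1
  have hV₀ := (H₀ x _ (fun y => 1 * pd1 G y)
    (continuous_const.aestronglyMeasurable.mul (measurable_pd1 hGc).aestronglyMeasurable)
    (hG.mul_pd1_le_weight hb)).1
  simp only [one_mul] at i₂ i₁ i₀ hV₁ hV₀
  have hD : Integrable (commDensity φ G x) := (i₂.add (i₁.const_mul 2)).sub i₀
  have hV : Integrable (fun y => -((G x - G y) * φ₁ (x - y)) - pd1 G y * φ (x - y)) :=
    hV₁.neg.sub hV₀
  rw [Measure.volume_eq_prod] at hD hV ⊢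
  rw [integral_prod_symm _ hD]
  refine integral_eq_zero_of_ae ?_
  filter_upwards [hD.prod_left_ae, hV.prod_left_ae, Measure.ae_ne volume (0 : ℝ)] with t hDt hVt ht
  refine integral_eq_zero_of_hasDerivAt_of_integrable (fun s => ?_) hDt hVt
  have dsub : HasDerivAt (fun s : ℝ => x.1 - s) (-1) s := by
    simpa using (hasDerivAt_id s).const_sub x.1
  have dφ : HasDerivAt (fun s : ℝ => φ (x - (s, t))) (pd1 φ (x - (s, t)) * -1) s :=
    (hasDerivAt_schwartz_fst φ (x.1 - s) (x.2 - t)).comp s dsub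
  have dφ₁ : HasDerivAt (fun s : ℝ => φ₁ (x - (s, t))) (pd1 φ₁ (x - (s, t)) * -1) s :=
    (hasDerivAt_schwartz_fst φ₁ (x.1 - s) (x.2 - t)).comp s dsub
  have dG := (hG.hasDerivAt s ht).const_sub (G x)
  have dG₁ := hG.hasDerivAt_pd1 s ht
  refine ((dG.mul dφ₁).neg.sub (dG₁.mul dφ)).congr_deriv ?_
  simp only [commDensity, h₁]
  ring

theorem commT_unit_bound {ψ : ℝ → ℝ × ℝ → ℝ} (hψ : IsPsiKernel ψ) {α : ℝ} (hα : 0 < α)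
    (hα1 : α < 1) :
    ∃ K : ℝ, ∀ (F G : ℝ × ℝ → ℝ) (BF AF A C : ℝ), (∀ x, |F x| ≤ BF) →
      (∀ x y : ℝ × ℝ, |F x - F y| ≤ AF * pdist x y ^ α) → IsAdmissible α A C G →
      ∀ x, |commT ψ 1 F G x| ≤ K * (C + A) * AF := by
  obtain ⟨φ, hφ⟩ := hψ.1 1 one_pos
  obtain ⟨K, hK⟩ := commDensity_bound hα hα1 φ
  refine ⟨K, fun F G BF AF A C hFB hF hG x => ?_⟩
  have hAF := nonneg_of_holder hF
  have hFc := continuous_of_holder hα hF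
  obtain ⟨iF, eF⟩ := commT_eq_integral_commDensity hα hα1 hφ hG hFc hFB x
  obtain ⟨ic, -⟩ := commT_eq_integral_commDensity hα hα1 hφ hG
    (continuous_const (y := F x)) (fun _ => hFB x) x
  have e : commT ψ 1 F G x = ∫ y, (F y - F x) * commDensity φ G x y := by
    simp only [sub_mul]
    rw [integral_sub iF ic, integral_const_mul, integral_commDensity_eq_zero hα hα1 φ hG,
      mul_zero, sub_zero, eF]
  rw [e]
  refine (hK A C G hG x AF (fun y => F y - F x) (hFc.sub continuous_const) fun y => ?_).2.2.2
  rw [abs_sub_comm]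
  have := pdist_rpow_le hα hα1 x y
  exact (hF x y).trans (by gcongr)

theorem commT_bound {ψ : ℝ → ℝ × ℝ → ℝ} (hψ : IsPsiKernel ψ) {α : ℝ} (hα : 0 < α)
    (hα1 : α < 1) :
    ∃ K : ℝ, ∀ (F G : ℝ × ℝ → ℝ) (BF AF A C : ℝ), (∀ x, |F x| ≤ BF) →
      (∀ x y : ℝ × ℝ, |F x - F y| ≤ AF * pdist x y ^ α) → IsAdmissible α A C G →
      ∀ T : ℝ, 0 < T → ∀ x, |commT ψ T F G x| ≤ K * (C + A) * AF * T ^ ((2 * α - 2) / 4) := by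
  obtain ⟨K, hK⟩ := commT_unit_bound hψ hα hα1
  refine ⟨K, fun F G BF AF A C hFB hF hG T hT x => ?_⟩
  obtain ⟨a, ha, rfl⟩ : ∃ a : ℝ, 0 < a ∧ a ^ 4 = T :=
    ⟨T ^ (1 / 4 : ℝ), by positivity, by
      rw [← Real.rpow_natCast, ← Real.rpow_mul hT.le]; norm_num⟩
  rw [← pdil_pdil_inv ha.ne' x, commT_pdil hψ ha, abs_mul,
    abs_of_pos (inv_pos.2 (pow_pos ha 2))]
  have h := hK (fun y => F (pdil a y)) _ BF (AF * a ^ α) _ _ (fun y => hFB _) (fun y z => by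
    refine (hF _ _).trans (le_of_eq ?_)
    rw [pdist_pdil ha.le, Real.mul_rpow ha.le (pdist_nonneg y z)]; ring)
    (hG.comp_pdil ha) (pdil a⁻¹ x)
  have hpow : (a ^ 4) ^ ((2 * α - 2) / 4) = (a ^ 2)⁻¹ * (a ^ α * a ^ α) := by
    rw [← Real.rpow_natCast a 4, ← Real.rpow_mul ha.le, ← Real.rpow_add ha,
      ← Real.rpow_natCast a 2, ← Real.rpow_neg ha.le, ← Real.rpow_add ha]
    congr 1; push_cast; ring
  calc _ ≤ (a ^ 2)⁻¹ * (K * (C * a ^ α + A * a ^ α) * (AF * a ^ α)) := by gcongr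
    _ = _ := by rw [hpow]; ring

theorem commT_sub {ψ : ℝ → ℝ × ℝ → ℝ} (hψ : IsPsiKernel ψ) {α : ℝ} (hα : 0 < α) (hα1 : α < 1)
    {T : ℝ} (hT : 0 < T) {F G₀ G₁ : ℝ × ℝ → ℝ} {B A₀ A₁ C₀ C₁ A C : ℝ} (hF : Continuous F)
    (hFB : ∀ x, |F x| ≤ B) (h₀ : IsAdmissible α A₀ C₀ G₀) (h₁ : IsAdmissible α A₁ C₁ G₁)
    (h : IsAdmissible α A C fun x => G₀ x - G₁ x)
    (e₁ : ∀ x : ℝ × ℝ, x.2 ≠ 0 → pd1 (fun x => G₀ x - G₁ x) x = pd1 G₀ x - pd1 G₁ x)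
    (e₂ : ∀ x : ℝ × ℝ, x.2 ≠ 0 →
      pd1 (pd1 (fun x => G₀ x - G₁ x)) x = pd1 (pd1 G₀) x - pd1 (pd1 G₁) x) (x : ℝ × ℝ) :
    commT ψ T F G₀ x - commT ψ T F G₁ x = commT ψ T F (fun x => G₀ x - G₁ x) x := by
  obtain ⟨φ, hφ⟩ := hψ.1 T hT
  obtain ⟨i₀, c₀⟩ := commT_eq_integral_commDensity hα hα1 hφ h₀ hF hFB x
  obtain ⟨i₁, c₁⟩ := commT_eq_integral_commDensity hα hα1 hφ h₁ hF hFB x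
  rw [c₀, c₁, (commT_eq_integral_commDensity hα hα1 hφ h hF hFB x).2, ← integral_sub i₀ i₁]
  refine integral_congr_ae ?_
  filter_upwards [ae_snd_ne_zero] with y hy
  simp only [commDensity, e₁ y hy, e₂ y hy]
  ring

end Estimate

/-- continuity of the generalized product `G ◊ ∂₁²F` in `G`. -/
theorem generalized_product_continuity_in_G
    (ψ : ℝ → ℝ × ℝ → ℝ) (hψ : IsPsiKernel ψ)
    (α : ℝ) (hα : 0 < α) (hα1 : α < 1) :
    ∃ C : ℝ, ∀ (F G0 G1 : ℝ × ℝ → ℝ) (BF AF AG0 AG1 CG0 CG1 CD AD : ℝ),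
      (∀ x : ℝ × ℝ, |F x| ≤ BF) →
      (∀ x y : ℝ × ℝ, |F x - F y| ≤ AF * pdist x y ^ α) →
      (∀ x y : ℝ × ℝ, |G0 x - G0 y| ≤ AG0 * pdist x y ^ α) →
      (∀ x y : ℝ × ℝ, |G1 x - G1 y| ≤ AG1 * pdist x y ^ α) →
      (∀ x : ℝ × ℝ, x.2 ≠ 0 → DifferentiableAt ℝ (fun s : ℝ => G0 (s, x.2)) x.1) →
      (∀ x : ℝ × ℝ, x.2 ≠ 0 → DifferentiableAt ℝ (fun s : ℝ => pd1 G0 (s, x.2)) x.1) →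
      (∀ x : ℝ × ℝ, x.2 ≠ 0 → DifferentiableAt ℝ (fun s : ℝ => G1 (s, x.2)) x.1) →
      (∀ x : ℝ × ℝ, x.2 ≠ 0 → DifferentiableAt ℝ (fun s : ℝ => pd1 G1 (s, x.2)) x.1) →
      (∀ x : ℝ × ℝ, x.2 ≠ 0 → |pd1 G0 x| ≤ CG0 * |x.2| ^ ((α - 1) / 2)) →
      (∀ x : ℝ × ℝ, x.2 ≠ 0 → |pd1 (pd1 G0) x| ≤ CG0 * |x.2| ^ ((α - 2) / 2)) →
      (∀ x : ℝ × ℝ, x.2 ≠ 0 → |pd1 G1 x| ≤ CG1 * |x.2| ^ ((α - 1) / 2)) →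
      (∀ x : ℝ × ℝ, x.2 ≠ 0 → |pd1 (pd1 G1) x| ≤ CG1 * |x.2| ^ ((α - 2) / 2)) →
      (∀ x : ℝ × ℝ, x.2 ≠ 0 → |pd1 G0 x - pd1 G1 x| ≤ CD * |x.2| ^ ((α - 1) / 2)) →
      (∀ x : ℝ × ℝ, x.2 ≠ 0 →
        |pd1 (pd1 G0) x - pd1 (pd1 G1) x| ≤ CD * |x.2| ^ ((α - 2) / 2)) →
      (∀ x y : ℝ × ℝ, |(G0 x - G1 x) - (G0 y - G1 y)| ≤ AD * pdist x y ^ α) →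
      ∀ T : ℝ, 0 < T → T ≤ 1 → ∀ x : ℝ × ℝ,
        |commT ψ T F G0 x - commT ψ T F G1 x|
          ≤ C * (CD + AD) * AF * T ^ ((2 * α - 2) / 4) := by
  obtain ⟨K, hK⟩ := commT_bound hψ hα hα1
  refine ⟨K, ?_⟩
  intro F G0 G1 BF AF AG0 AG1 CG0 CG1 CD AD hFB hF hG0 hG1 hd0 hdd0 hd1 hdd1 hb0 hbb0 hb1 hbb1
    hD hDD hA T hT _ x
  have h₀ : IsAdmissible α AG0 CG0 G0 := ⟨hG0, hd0, hdd0, hb0, hbb0⟩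
  have h₁ : IsAdmissible α AG1 CG1 G1 := ⟨hG1, hd1, hdd1, hb1, hbb1⟩
  obtain ⟨h, e₁, e₂⟩ := h₀.sub h₁ hA hD hDD
  rw [commT_sub hψ hα hα1 hT (continuous_of_holder hα hF) hFB h₀ h₁ h e₁ e₂]
  exact hK F _ BF AF AD CD hFB hF h T hT x
end

section
/- Let α ∈ (2/3, 1) and λ > 0. Let u : ℝ → ℝ be bounded, v : ℝ × [λ,1] → ℝ a family of bounded functions, a : ℝ → [λ,1], ν : ℝ → ℝ bounded, and M_∂ ≥ 0, and assume the boundary modelling inequality: for all x₁, y₁ ∈ ℝ, |u(y₁) − u(x₁) − (v(y₁, a(x₁)) − v(x₁, a(x₁))) − ν(x₁)·(y₁ − x₁)| ≤ M_∂ · |y₁ − x₁|^{2α}. Then there is a constant C(α, λ) such that for all x = (x₁, x₂) with x₂ > 0: |∫_ℝ (u(y) − v(y, a(x₁))) · ∂₁²G(x₁ − y, x₂, a(x₁)) dy| ≤ C · M_∂ · x₂^{α−1}, where G(x₁, x₂, a₀) = (4π a₀ x₂)^{−1/2} exp(−x₁²/(4 a₀ x₂) − x₂) and ∂₁² acts on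 the first argument of G. -/
open MeasureTheory

/-- The heat kernel (with massive term) of the operator `∂₂ - a₀∂₁² + 1`. -/
noncomputable def heatG (x1 x2 a0 : ℝ) : ℝ :=
  (4 * Real.pi * a0 * x2) ^ (-(1 : ℝ) / 2) * Real.exp (-(x1 ^ 2) / (4 * a0 * x2) - x2)

/-- Absolute Gaussian moments. -/
theorem integral_abs_rpow_mul_exp_neg_mul_sq {b q : ℝ} (hb : 0 < b) (hq : -1 < q) :
    ∫ z : ℝ, |z| ^ q * Real.exp (-b * z ^ 2)
      = b ^ (-(q + 1) / 2) * Real.Gamma ((q + 1) / 2) := by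
  have h := integral_comp_abs (f := fun z : ℝ => z ^ q * Real.exp (-b * z ^ 2))
  simp only [sq_abs] at h
  have h2 := integral_rpow_mul_exp_neg_mul_rpow (p := 2) (by norm_num) hq hb
  simp only [Real.rpow_two] at h2
  rw [h, h2]
  ring

theorem integrable_abs_rpow_mul_exp_neg_mul_sq {b q : ℝ} (hb : 0 < b) (hq : -1 < q) :
    Integrable fun z : ℝ => |z| ^ q * Real.exp (-b * z ^ 2) := by
  refine Integrable.of_integral_ne_zero ?_
  rw [integral_abs_rpow_mul_exp_neg_mul_sq hb hq]
  have : 0 < Real.Gamma ((q + 1) / 2) := Real.Gamma_pos_of_pos (by linarith)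
  positivity

theorem integrable_pow_mul_exp_neg_mul_sq {b : ℝ} (hb : 0 < b) (n : ℕ) :
    Integrable fun z : ℝ => z ^ n * Real.exp (-b * z ^ 2) := by
  have h := integrable_rpow_mul_exp_neg_mul_sq (s := n) hb
    (by have : (0 : ℝ) ≤ n := n.cast_nonneg
        linarith)
  simpa only [Real.rpow_natCast] using h

theorem hasDerivAt_exp_neg_mul_sq (b z : ℝ) :
    HasDerivAt (fun z : ℝ => Real.exp (-b * z ^ 2)) (-2 * b * z * Real.exp (-b * z ^ 2)) z := by
  convert ((hasDerivAt_pow 2 z).const_mul (-b)).exp using 1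
  push_cast
  ring

theorem hasDerivAt_deriv_exp_neg_mul_sq (b z : ℝ) :
    HasDerivAt (fun z : ℝ => -2 * b * z * Real.exp (-b * z ^ 2))
      ((4 * b ^ 2 * z ^ 2 - 2 * b) * Real.exp (-b * z ^ 2)) z := by
  refine (((hasDerivAt_id z).const_mul (-2 * b)).mul (hasDerivAt_exp_neg_mul_sq b z)).congr_deriv ?_
  simp only [id]
  ring

theorem integrable_deriv_two_exp_neg_mul_sq {b : ℝ} (hb : 0 < b) :
    Integrable fun z : ℝ => (4 * b ^ 2 * z ^ 2 - 2 * b) * Real.exp (-b * z ^ 2) := by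
  convert ((integrable_pow_mul_exp_neg_mul_sq hb 2).const_mul (4 * b ^ 2)).sub
    ((integrable_pow_mul_exp_neg_mul_sq hb 0).const_mul (2 * b)) using 1
  ext z
  simp only [Pi.sub_apply]
  ring

theorem integrable_id_mul_deriv_two_exp_neg_mul_sq {b : ℝ} (hb : 0 < b) :
    Integrable fun z : ℝ => z * ((4 * b ^ 2 * z ^ 2 - 2 * b) * Real.exp (-b * z ^ 2)) := by
  convert ((integrable_pow_mul_exp_neg_mul_sq hb 3).const_mul (4 * b ^ 2)).sub
    ((integrable_pow_mul_exp_neg_mul_sq hb 1).const_mul (2 * b)) using 1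
  ext z
  simp only [Pi.sub_apply]
  ring

theorem integral_deriv_two_exp_neg_mul_sq {b : ℝ} (hb : 0 < b) :
    ∫ z : ℝ, (4 * b ^ 2 * z ^ 2 - 2 * b) * Real.exp (-b * z ^ 2) = 0 := by
  refine integral_eq_zero_of_hasDerivAt_of_integrable (hasDerivAt_deriv_exp_neg_mul_sq b)
    (integrable_deriv_two_exp_neg_mul_sq hb) ?_
  convert (integrable_pow_mul_exp_neg_mul_sq hb 1).const_mul (-2 * b) using 1
  ext z
  ring

theorem integral_id_mul_deriv_two_exp_neg_mul_sq {b : ℝ} (hb : 0 < b) :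
    ∫ z : ℝ, z * ((4 * b ^ 2 * z ^ 2 - 2 * b) * Real.exp (-b * z ^ 2)) = 0 := by
  refine integral_eq_zero_of_hasDerivAt_of_integrable
    (f := fun z => z * (-2 * b * z * Real.exp (-b * z ^ 2)) - Real.exp (-b * z ^ 2))
    (fun z => ?_) (integrable_id_mul_deriv_two_exp_neg_mul_sq hb) ?_
  · refine (((hasDerivAt_id z).mul (hasDerivAt_deriv_exp_neg_mul_sq b z)).sub
      (hasDerivAt_exp_neg_mul_sq b z)).congr_deriv ?_
    simp only [id]
    ring
  · convert ((integrable_pow_mul_exp_neg_mul_sq hb 2).const_mul (-2 * b)).sub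
      (integrable_pow_mul_exp_neg_mul_sq hb 0) using 1
    ext z
    simp only [Pi.sub_apply]
    ring

/-- The second derivative of a Gaussian annihilates affine functions, so it only sees the deviation
of `W` from an affine function. -/
theorem abs_integral_mul_deriv_two_exp_neg_mul_sq_le {b p M c d : ℝ} {W : ℝ → ℝ} (hb : 0 < b)
    (hp : 0 ≤ p) (hM : 0 ≤ M) (hW : ∀ z, |W z - c - d * z| ≤ M * |z| ^ p) :
    |∫ z : ℝ, W z * ((4 * b ^ 2 * z ^ 2 - 2 * b) * Real.exp (-b * z ^ 2))|
      ≤ M * ((4 * Real.Gamma ((p + 3) / 2) + 2 * Real.Gamma ((p + 1) / 2))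
        * b ^ ((1 - p) / 2)) := by
  have hΓ₁ : 0 < Real.Gamma ((p + 1) / 2) := Real.Gamma_pos_of_pos (by linarith)
  have hΓ₃ : 0 < Real.Gamma ((p + 3) / 2) := Real.Gamma_pos_of_pos (by linarith)
  by_cases hWint : Integrable fun z : ℝ =>
      W z * ((4 * b ^ 2 * z ^ 2 - 2 * b) * Real.exp (-b * z ^ 2))
  swap
  · rw [integral_undef hWint, abs_zero]
    positivity
  have hc := (integrable_deriv_two_exp_neg_mul_sq hb).const_mul c
  have hd := (integrable_id_mul_deriv_two_exp_neg_mul_sq hb).const_mul d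
  have key : ∫ z : ℝ, W z * ((4 * b ^ 2 * z ^ 2 - 2 * b) * Real.exp (-b * z ^ 2))
      = ∫ z : ℝ, (W z - c - d * z)
        * ((4 * b ^ 2 * z ^ 2 - 2 * b) * Real.exp (-b * z ^ 2)) := by
    have h := integral_sub (hWint.sub hc) hd
    have h' := integral_sub hWint hc
    simp only [Pi.sub_apply] at h
    rw [integral_const_mul, integral_id_mul_deriv_two_exp_neg_mul_sq hb, h', integral_const_mul,
      integral_deriv_two_exp_neg_mul_sq hb, mul_zero, mul_zero, sub_zero, sub_zero] at h
    rw [← h]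
    congr 1
    ext z
    ring
  have hi₁ := (integrable_abs_rpow_mul_exp_neg_mul_sq (q := p) hb (by linarith)).const_mul (2 * b)
  have hi₃ := (integrable_abs_rpow_mul_exp_neg_mul_sq (q := p + 2) hb
    (by linarith)).const_mul (4 * b ^ 2)
  have hpt : ∀ z : ℝ, ‖(W z - c - d * z)
      * ((4 * b ^ 2 * z ^ 2 - 2 * b) * Real.exp (-b * z ^ 2))‖
      ≤ M * (4 * b ^ 2 * (|z| ^ (p + 2) * Real.exp (-b * z ^ 2))
        + 2 * b * (|z| ^ p * Real.exp (-b * z ^ 2))) := by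
    intro z
    have hz : |z| ^ (p + 2) = |z| ^ p * z ^ 2 := by
      rw [Real.rpow_add_of_nonneg (abs_nonneg z) hp (by norm_num), Real.rpow_two, sq_abs]
    have hk : |4 * b ^ 2 * z ^ 2 - 2 * b| ≤ 4 * b ^ 2 * z ^ 2 + 2 * b := by
      rw [abs_le]
      constructor <;> nlinarith [mul_nonneg (sq_nonneg b) (sq_nonneg z)]
    rw [Real.norm_eq_abs, abs_mul, abs_mul, Real.abs_exp, hz]
    calc _ ≤ (M * |z| ^ p) * ((4 * b ^ 2 * z ^ 2 + 2 * b) * Real.exp (-b * z ^ 2)) := by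
          gcongr
          exact hW z
      _ = _ := by ring
  rw [key]
  refine (norm_integral_le_of_norm_le ((hi₃.add hi₁).const_mul M)
    (Filter.Eventually.of_forall hpt)).trans (le_of_eq ?_)
  simp only [Pi.add_apply]
  rw [integral_const_mul, integral_add hi₃ hi₁, integral_const_mul, integral_const_mul,
    integral_abs_rpow_mul_exp_neg_mul_sq hb (by linarith),
    integral_abs_rpow_mul_exp_neg_mul_sq hb (by linarith)]
  have e₁ : b ^ ((1 - p) / 2) = b * b ^ (-(p + 1) / 2) := by
    nth_rewrite 2 [← Real.rpow_one b]
    rw [← Real.rpow_add hb]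
    congr 1
    ring
  have e₃ : b ^ ((1 - p) / 2) = b ^ 2 * b ^ (-(p + 2 + 1) / 2) := by
    rw [← Real.rpow_two, ← Real.rpow_add hb]
    congr 1
    ring
  have e : (p + 2 + 1) / 2 = (p + 3) / 2 := by ring
  rw [e, add_mul, mul_right_comm 4, mul_right_comm 2]
  nth_rewrite 1 [e₃]
  rw [e₁]
  ring

theorem iteratedDeriv_two_heatG (x2 a0 s : ℝ) :
    iteratedDeriv 2 (fun s : ℝ => heatG s x2 a0) s
      = (4 * Real.pi * a0 * x2) ^ (-(1 : ℝ) / 2) * Real.exp (-x2)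
        * ((4 * (4 * a0 * x2)⁻¹ ^ 2 * s ^ 2 - 2 * (4 * a0 * x2)⁻¹)
          * Real.exp (-(4 * a0 * x2)⁻¹ * s ^ 2)) := by
  have hG : (fun s : ℝ => heatG s x2 a0) = fun s =>
      (4 * Real.pi * a0 * x2) ^ (-(1 : ℝ) / 2) * Real.exp (-x2)
        * Real.exp (-(4 * a0 * x2)⁻¹ * s ^ 2) := by
    ext s
    rw [heatG, mul_assoc _ (Real.exp _), ← Real.exp_add]
    congr 2
    ring
  rw [hG, iteratedDeriv_succ, iteratedDeriv_one]
  have h' : deriv _ = _ := funext fun s => ((hasDerivAt_exp_neg_mul_sq (4 * a0 * x2)⁻¹ s).const_mul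
    ((4 * Real.pi * a0 * x2) ^ (-(1 : ℝ) / 2) * Real.exp (-x2))).deriv
  rw [h']
  exact ((hasDerivAt_deriv_exp_neg_mul_sq (4 * a0 * x2)⁻¹ s).const_mul _).deriv

/-- the boundary modelling of `u` after `v` propagates into a
pointwise bound on `∫ (u - v(·, a(x₁))) ∂₁²G dy`. -/
theorem boundary_modelling_heat_kernel_bound
    (α lam : ℝ) (hα : 2 / 3 < α) (hα1 : α < 1) (hlam : 0 < lam) :
    ∃ C : ℝ, ∀ (u ν : ℝ → ℝ) (v : ℝ → ℝ → ℝ) (a : ℝ → ℝ) (M : ℝ),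
      (∃ B : ℝ, ∀ y : ℝ, |u y| ≤ B) →
      (∃ B : ℝ, ∀ y : ℝ, ∀ a₀ ∈ Set.Icc lam 1, |v y a₀| ≤ B) →
      (∀ s : ℝ, a s ∈ Set.Icc lam 1) →
      (∃ B : ℝ, ∀ s : ℝ, |ν s| ≤ B) →
      0 ≤ M →
      (∀ x1 y1 : ℝ,
        |u y1 - u x1 - (v y1 (a x1) - v x1 (a x1)) - ν x1 * (y1 - x1)|
          ≤ M * |y1 - x1| ^ (2 * α)) →
      ∀ x1 x2 : ℝ, 0 < x2 →
        |∫ y : ℝ, (u y - v y (a x1))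
            * iteratedDeriv 2 (fun s : ℝ => heatG s x2 (a x1)) (x1 - y)|
          ≤ C * M * x2 ^ (α - 1) := by
  have hΓ₁ : 0 < Real.Gamma ((2 * α + 1) / 2) := Real.Gamma_pos_of_pos (by linarith)
  have hΓ₃ : 0 < Real.Gamma ((2 * α + 3) / 2) := Real.Gamma_pos_of_pos (by linarith)
  refine ⟨Real.pi ^ (-(1 : ℝ) / 2) * (4 * lam) ^ (α - 1) *
    (4 * Real.Gamma ((2 * α + 3) / 2) + 2 * Real.Gamma ((2 * α + 1) / 2)), ?_⟩
  intro u ν v a M _ _ ha _ hM h x1 x2 hx2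
  have ha0 : 0 < a x1 := hlam.trans_le (ha x1).1
  have ht : 0 < 4 * a x1 * x2 := by positivity
  have hle := abs_integral_mul_deriv_two_exp_neg_mul_sq_le (b := (4 * a x1 * x2)⁻¹) (p := 2 * α)
    (c := u x1 - v x1 (a x1)) (d := -ν x1) (W := fun z => u (x1 - z) - v (x1 - z) (a x1))
    (inv_pos.2 ht) (by linarith) hM (fun z => by
      convert h x1 (x1 - z) using 2
      · ring
      · rw [sub_sub_cancel_left, abs_neg])
  rw [← integral_sub_left_eq_self _ volume x1]
  simp only [sub_sub_cancel, iteratedDeriv_two_heatG]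
  simp only [mul_left_comm _ ((4 * Real.pi * a x1 * x2) ^ (-(1 : ℝ) / 2) * Real.exp (-x2))]
  rw [integral_const_mul, abs_mul, abs_of_nonneg (by positivity)]
  have hpi : (4 * Real.pi * a x1 * x2) ^ (-(1 : ℝ) / 2)
      = Real.pi ^ (-(1 : ℝ) / 2) * (4 * a x1 * x2) ^ (-(1 : ℝ) / 2) := by
    rw [← Real.mul_rpow Real.pi_pos.le ht.le]
    congr 1
    ring
  have hpow : (4 * a x1 * x2) ^ (-(1 : ℝ) / 2) * (4 * a x1 * x2)⁻¹ ^ ((1 - 2 * α) / 2)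
      ≤ (4 * lam) ^ (α - 1) * x2 ^ (α - 1) := by
    rw [Real.inv_rpow ht.le, ← Real.rpow_neg ht.le, ← Real.rpow_add ht,
      ← Real.mul_rpow (by positivity) hx2.le]
    have e : -(1 : ℝ) / 2 + -((1 - 2 * α) / 2) = α - 1 := by ring
    rw [e]
    refine Real.rpow_le_rpow_of_nonpos (by positivity) ?_ (by linarith)
    gcongr
    exact (ha x1).1
  have hexp : Real.exp (-x2) ≤ 1 := Real.exp_le_one_iff.2 (by linarith)
  calc _ ≤ (4 * Real.pi * a x1 * x2) ^ (-(1 : ℝ) / 2) * 1 *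
        (M * ((4 * Real.Gamma ((2 * α + 3) / 2) + 2 * Real.Gamma ((2 * α + 1) / 2))
          * (4 * a x1 * x2)⁻¹ ^ ((1 - 2 * α) / 2))) := by gcongr
    _ = Real.pi ^ (-(1 : ℝ) / 2) * M *
        (4 * Real.Gamma ((2 * α + 3) / 2) + 2 * Real.Gamma ((2 * α + 1) / 2)) *
        ((4 * a x1 * x2) ^ (-(1 : ℝ) / 2) * (4 * a x1 * x2)⁻¹ ^ ((1 - 2 * α) / 2)) := by
      rw [hpi]
      ring
    _ ≤ Real.pi ^ (-(1 : ℝ) / 2) * M *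
        (4 * Real.Gamma ((2 * α + 3) / 2) + 2 * Real.Gamma ((2 * α + 1) / 2)) *
        ((4 * lam) ^ (α - 1) * x2 ^ (α - 1)) := by gcongr
    _ = _ := by ring
end
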